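/- Let ∇_V be a connection on an A-module V and ∇_W a connection on an A-module W, both relative to the same derivation d. Then there exists a unique k-linear map ∇ : V ⊗_A W → Ω ⊗_A (V ⊗_A W) such that for all v ∈ V and w ∈ W, ∇(v ⊗ w) = α(∇_V(v) ⊗ w) + β(v ⊗ ∇_W(w)), where α : (Ω ⊗_A V) ⊗_A W → Ω ⊗_A (V ⊗_A W) is the A-linear associator isomorphism and β : V ⊗_A (Ω ⊗_A W) → Ω ⊗_A (V ⊗_A W) is the A-linear map determined by v ⊗ (ω ⊗ w) ↦ ω ⊗ (v ⊗ w); moreover ∇ is itself a connection on V ⊗_A W relative to d. -/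

import Mathlib

open scoped TensorProduct

/-- given connections `nV` on `V` and `nW` on `W` (relative to the same
derivation `d : A → Ω`), there is a unique `k`-linear map
`D : V ⊗[A] W → Ω ⊗[A] (V ⊗[A] W)` with
`D (v ⊗ w) = α (nV v ⊗ w) + β (v ⊗ nW w)`, where `α` is the associator and `β` is
the `A`-linear map determined by `v ⊗ (ω ⊗ w) ↦ ω ⊗ (v ⊗ w)`; moreover any such `D`
is itself a connection on `V ⊗[A] W` relative to `d`. -/
theorem stmt8 {k A Ω V W : Type*} [CommRing k] [CommRing A] [Algebra k A]
    [AddCommGroup Ω] [Module k Ω] [Module A Ω] [IsScalarTower k A Ω]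
    [AddCommGroup V] [Module k V] [Module A V] [IsScalarTower k A V]
    [AddCommGroup W] [Module k W] [Module A W] [IsScalarTower k A W]
    (d : A →ₗ[k] Ω) (hd : ∀ a b : A, d (a * b) = a • d b + b • d a)
    (nV : V →ₗ[k] Ω ⊗[A] V)
    (hnV : ∀ (a : A) (v : V), nV (a • v) = a • nV v + d a ⊗ₜ[A] v)
    (nW : W →ₗ[k] Ω ⊗[A] W)
    (hnW : ∀ (a : A) (w : W), nW (a • w) = a • nW w + d a ⊗ₜ[A] w)
    (β : V ⊗[A] (Ω ⊗[A] W) →ₗ[A] Ω ⊗[A] (V ⊗[A] W))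
    (hβ : ∀ (v : V) (ω : Ω) (w : W), β (v ⊗ₜ[A] (ω ⊗ₜ[A] w)) = ω ⊗ₜ[A] (v ⊗ₜ[A] w)) :
    (∃! D : V ⊗[A] W →ₗ[k] Ω ⊗[A] (V ⊗[A] W),
      ∀ (v : V) (w : W), D (v ⊗ₜ[A] w) =
        (TensorProduct.assoc A Ω V W) ((nV v) ⊗ₜ[A] w) + β (v ⊗ₜ[A] (nW w))) ∧
    (∀ D : V ⊗[A] W →ₗ[k] Ω ⊗[A] (V ⊗[A] W),
      (∀ (v : V) (w : W), D (v ⊗ₜ[A] w) =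
        (TensorProduct.assoc A Ω V W) ((nV v) ⊗ₜ[A] w) + β (v ⊗ₜ[A] (nW w))) →
      ∀ (a : A) (x : V ⊗[A] W), D (a • x) = a • D x + d a ⊗ₜ[A] x) := by
  have leibniz : ∀ D : V ⊗[A] W →+ Ω ⊗[A] (V ⊗[A] W),
      (∀ (v : V) (w : W), D (v ⊗ₜ[A] w) =
        (TensorProduct.assoc A Ω V W) ((nV v) ⊗ₜ[A] w) + β (v ⊗ₜ[A] (nW w))) →
      ∀ (a : A) (x : V ⊗[A] W), D (a • x) = a • D x + d a ⊗ₜ[A] x := by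
    intro D hD a x
    induction x with
    | zero => simp
    | add x y hx hy =>
      rw [smul_add, map_add, hx, hy, map_add, smul_add, TensorProduct.tmul_add]
      abel
    | tmul v w =>
      rw [TensorProduct.smul_tmul', hD, hD, hnV, TensorProduct.add_tmul, map_add,
        TensorProduct.assoc_tmul, ← TensorProduct.smul_tmul', map_smul,
        ← TensorProduct.smul_tmul', map_smul, smul_add]
      abel
  let f : V →+ W →+ Ω ⊗[A] (V ⊗[A] W) :=
    AddMonoidHom.mk' (fun v => AddMonoidHom.mk'
      (fun w => (TensorProduct.assoc A Ω V W) ((nV v) ⊗ₜ[A] w) + β (v ⊗ₜ[A] (nW w)))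
      (fun w w' => by
        simp only [map_add, TensorProduct.tmul_add]
        abel))
      (fun v v' => by
        ext w
        simp only [map_add, TensorProduct.add_tmul, AddMonoidHom.mk'_apply,
          AddMonoidHom.add_apply]
        abel)
  have hf : ∀ (a : A) (v : V) (w : W), f (a • v) w = f v (a • w) := by
    intro a v w
    simp only [f, AddMonoidHom.mk'_apply, hnV, hnW, TensorProduct.add_tmul,
      TensorProduct.tmul_add, TensorProduct.tmul_smul, ← TensorProduct.smul_tmul',
      map_add, map_smul, TensorProduct.assoc_tmul, hβ]
    abel
  let D₀ : V ⊗[A] W →+ Ω ⊗[A] (V ⊗[A] W) := TensorProduct.liftAddHom f hf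
  have hD₀ : ∀ (v : V) (w : W), D₀ (v ⊗ₜ[A] w) =
      (TensorProduct.assoc A Ω V W) ((nV v) ⊗ₜ[A] w) + β (v ⊗ₜ[A] (nW w)) :=
    fun v w => TensorProduct.liftAddHom_tmul f hf v w
  have hsmul : ∀ (c : k) (x : V ⊗[A] W), D₀ (c • x) = c • D₀ x := by
    intro c x
    induction x with
    | zero => simp
    | add x y hx hy => rw [smul_add, map_add, hx, hy, map_add, smul_add]
    | tmul v w =>
      rw [TensorProduct.smul_tmul', hD₀, hD₀, map_smul, ← algebraMap_smul A c (nV v),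
        ← algebraMap_smul A c v, ← TensorProduct.smul_tmul', ← TensorProduct.smul_tmul',
        map_smul, map_smul, ← smul_add, algebraMap_smul]
  refine ⟨⟨{ D₀ with map_smul' := hsmul }, hD₀, fun D hD => ?_⟩,
    fun D hD => leibniz D.toAddMonoidHom hD⟩
  ext x
  induction x with
  | zero => simp only [map_zero]
  | add x y hx hy => rw [map_add, map_add, hx, hy]
  | tmul v w => exact (hD v w).trans (hD₀ v w).symm
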